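/- Let n, q ∈ ℕ with n ≥ 1 and q ≥ 1, and define f : ℝ → ℝ by f(x) = ∑_{k=1}^n exp(x^{kq+1}). Then f is simple of exact order n on ℝ, and the function h : ℝ → ℝ defined by h(x) = f(x^{1/q}) is simple of exact order n·q on (0,∞). -/

import Mathlib

open Real Finset

/-- `f` satisfies a simple differential equation of order ≤ `n` on `S`. -/
def SimpleDE (f : ℝ → ℝ) (n : ℕ) (S : Set ℝ) : Prop :=
  ∃ p : ℕ → Polynomial ℝ, (∃ k ≤ n, p k ≠ 0) ∧
    ∀ x ∈ S, ∑ k ∈ Finset.range (n + 1), (p k).eval x * iteratedDeriv k f x = 0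

/-- `f` is simple of exact order `n` on `S`. -/
def ExactOrder (f : ℝ → ℝ) (n : ℕ) (S : Set ℝ) : Prop :=
  SimpleDE f n S ∧ ¬ SimpleDE f (n - 1) S

open Polynomial in
/-- With `t = x ^ (1 / r)`, the `j`-th derivative in `x` of `exp (t ^ m)` is
`x⁻ʲ * (eulerPoly r m j).eval t * exp (t ^ m)`. -/
noncomputable def eulerPoly (r m : ℕ) : ℕ → Polynomial ℝ
  | 0 => 1
  | j + 1 => C (1 / (r : ℝ)) * (X * derivative (eulerPoly r m j)
      + C (m : ℝ) * (eulerPoly r m j * X ^ m)) - C (j : ℝ) * eulerPoly r m j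

open Polynomial in
theorem natDegree_eulerPoly_le (r m j : ℕ) : (eulerPoly r m j).natDegree ≤ j * m := by
  induction j with
  | zero => simp [eulerPoly]
  | succ j ih =>
    have hle : j * m ≤ (j + 1) * m := Nat.mul_le_mul_right m j.le_succ
    rw [eulerPoly]
    refine (natDegree_sub_le_of_le ((natDegree_C_mul_le _ _).trans (natDegree_add_le_of_degree_le
      ?_ ((natDegree_C_mul_le _ _).trans ?_)))
      ((natDegree_C_mul_le _ _).trans (ih.trans hle))).trans (max_self ((j + 1) * m)).le
    · refine natDegree_le_iff_coeff_eq_zero.2 fun N hN => ?_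
      obtain _ | N := N
      · simp
      · rw [coeff_X_mul, coeff_derivative, coeff_eq_zero_of_natDegree_lt (by omega), zero_mul]
    · exact natDegree_mul_le.trans (by rw [natDegree_X_pow, Nat.succ_mul]; omega)

open Polynomial in
theorem coeff_eulerPoly (r : ℕ) {m : ℕ} (hm : 0 < m) (j : ℕ) :
    (eulerPoly r m j).coeff (j * m) = ((m : ℝ) / r) ^ j := by
  induction j with
  | zero => simp [eulerPoly]
  | succ j ih =>
    have hdeg := natDegree_eulerPoly_le r m j
    obtain ⟨N, hN⟩ : ∃ N, (j + 1) * m = N + 1 := ⟨(j + 1) * m - 1, by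
      have : 0 < (j + 1) * m := by positivity
      omega⟩
    have hlt : j * m < (j + 1) * m := by rw [Nat.succ_mul]; omega
    have hX : (X * derivative (eulerPoly r m j)).coeff ((j + 1) * m) = 0 := by
      rw [hN, coeff_X_mul, coeff_derivative, coeff_eq_zero_of_natDegree_lt (by omega), zero_mul]
    rw [eulerPoly, coeff_sub, coeff_C_mul, coeff_C_mul, coeff_add, hX, coeff_C_mul,
      coeff_eq_zero_of_natDegree_lt (hdeg.trans_lt hlt), Nat.succ_mul, coeff_mul_X_pow, ih]
    ring

theorem natDegree_eulerPoly {r m : ℕ} (hr : 0 < r) (hm : 0 < m) (j : ℕ) :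
    (eulerPoly r m j).natDegree = j * m := by
  refine (natDegree_eulerPoly_le r m j).antisymm (Polynomial.le_natDegree_of_ne_zero ?_)
  rw [coeff_eulerPoly r hm]
  positivity

theorem eulerPoly_ne_zero {r m : ℕ} (hr : 0 < r) (hm : 0 < m) (j : ℕ) :
    eulerPoly r m j ≠ 0 := by
  intro h0
  have h1 := coeff_eulerPoly r hm j
  have h2 : ((m : ℝ) / r) ^ j ≠ 0 := by positivity
  rw [h0, Polynomial.coeff_zero] at h1
  exact h2 h1.symm

theorem pow_mul_iteratedDeriv_sum_exp {r : ℕ} (hr : 0 < r) {ι : Type*} (s : Finset ι) (m : ι → ℕ)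
    {h : ℝ → ℝ} (hh : ∀ x : ℝ, h x = ∑ k ∈ s, exp ((x ^ (1 / (r : ℝ))) ^ m k)) (j : ℕ) :
    ∀ x : ℝ, 0 < x → x ^ j * iteratedDeriv j h x =
      ∑ k ∈ s, (eulerPoly r (m k) j).eval (x ^ (1 / (r : ℝ))) *
        exp ((x ^ (1 / (r : ℝ))) ^ m k) := by
  induction j with
  | zero => intro x _; simp [eulerPoly, hh]
  | succ j ih =>
    intro x hx
    set t : ℝ := x ^ (1 / (r : ℝ)) with ht
    have hr' : (r : ℝ) ≠ 0 := by positivity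
    have hT : HasDerivAt (fun y : ℝ => y ^ (1 / (r : ℝ))) (t / (r * x)) x := by
      convert Real.hasDerivAt_rpow_const (p := 1 / (r : ℝ)) (Or.inl hx.ne') using 1
      rw [Real.rpow_sub_one hx.ne', ← ht]
      field_simp
    have hG : HasDerivAt (fun y : ℝ => ∑ k ∈ s, (eulerPoly r (m k) j).eval (y ^ (1 / (r : ℝ))) *
        exp ((y ^ (1 / (r : ℝ))) ^ m k))
        (∑ k ∈ s, ((eulerPoly r (m k) j).derivative.eval t * (t / (r * x)) * exp (t ^ m k) +
          (eulerPoly r (m k) j).eval t *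
            (exp (t ^ m k) * (m k * t ^ (m k - 1) * (t / (r * x)))))) x := by
      refine HasDerivAt.fun_sum fun k _ => HasDerivAt.mul ?_ ?_
      · exact ((eulerPoly r (m k) j).hasDerivAt t).comp x hT
      · exact (hT.pow (m k)).exp
    have hE : iteratedDeriv j h =ᶠ[nhds x] fun y => (∑ k ∈ s,
        (eulerPoly r (m k) j).eval (y ^ (1 / (r : ℝ))) * exp ((y ^ (1 / (r : ℝ))) ^ m k)) /
          y ^ j := by
      filter_upwards [lt_mem_nhds hx] with y hy
      rw [← ih y hy, mul_div_cancel_left₀ _ (pow_pos hy j).ne']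
    have hD := (hG.div (hasDerivAt_pow j x) (pow_pos hx j).ne').congr_of_eventuallyEq hE
    rw [iteratedDeriv_succ, hD.deriv]
    have hj : (j : ℝ) * x ^ (j - 1) = j * x ^ j / x := by
      obtain _ | j := j
      · simp
      · rw [Nat.add_sub_cancel, pow_succ]; field_simp
    rw [hj]
    have key : ∀ A B : ℝ, x ^ (j + 1) * ((A * x ^ j - B * (j * x ^ j / x)) / (x ^ j) ^ 2)
        = x * A - j * B := by
      intro A B
      field_simp
      ring
    rw [key, Finset.mul_sum, Finset.mul_sum, ← Finset.sum_sub_distrib]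
    refine Finset.sum_congr rfl fun k _ => ?_
    have hmk : (m k : ℝ) * t ^ (m k - 1) * t = m k * t ^ m k := by
      rcases Nat.eq_zero_or_pos (m k) with h0 | h0
      · simp [h0]
      · rw [mul_assoc, pow_sub_one_mul h0.ne']
    simp only [eulerPoly, Polynomial.eval_sub, Polynomial.eval_mul, Polynomial.eval_add,
      Polynomial.eval_C, Polynomial.eval_X, Polynomial.eval_pow]
    have : (m k : ℝ) * t ^ (m k - 1) * (t / (r * x)) = m k * t ^ m k / (r * x) := by
      rw [← hmk]; ring
    rw [this, ← ht]
    field_simp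

open Filter Topology in
theorem tendsto_eval_mul_exp_pow_sub_pow (Q : Polynomial ℝ) {a b : ℕ} (ha : 0 < a) (hab : a < b) :
    Tendsto (fun t : ℝ => Q.eval t * exp (t ^ a - t ^ b)) atTop (𝓝 0) := by
  refine squeeze_zero_norm' ?_ ((norm_zero (E := ℝ) ▸ (Polynomial.tendsto_div_exp_atTop Q).norm))
  filter_upwards [eventually_ge_atTop 2] with t ht
  have h1 : t ≤ t ^ a := le_self_pow₀ (by linarith) ha.ne'
  have h2 : t ^ (a + 1) ≤ t ^ b := pow_le_pow_right₀ (by linarith) hab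
  have h3 : t ^ a * 2 ≤ t ^ (a + 1) := by rw [pow_succ]; gcongr
  rw [norm_mul, norm_div, Real.norm_of_nonneg (exp_pos _).le, Real.norm_of_nonneg (exp_pos _).le,
    div_eq_mul_inv, ← Real.exp_neg]
  gcongr
  linarith

open Filter Topology in
/-- The functions `exp (t ^ m)`, `m ≥ 1`, are linearly independent over the polynomials. -/
theorem eq_zero_of_sum_eval_mul_exp_pow_eq_zero (s : Finset ℕ) {m : ℕ → ℕ} (hm : StrictMono m)
    (hm0 : ∀ k, 0 < m k) (Q : ℕ → Polynomial ℝ)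
    (hQ : ∀ t : ℝ, 0 < t → ∑ k ∈ s, (Q k).eval t * exp (t ^ m k) = 0) :
    ∀ k ∈ s, Q k = 0 := by
  induction s using Finset.induction_on_max with
  | empty => simp
  | insert a s hs ih =>
    have has : a ∉ s := fun h => (hs a h).false
    have hlim : Tendsto (fun t : ℝ => -∑ k ∈ s, (Q k).eval t * exp (t ^ m k - t ^ m a))
        atTop (𝓝 0) := by
      simpa using (tendsto_finsetSum s fun k hk =>
        tendsto_eval_mul_exp_pow_sub_pow (Q k) (hm0 k) (hm (hs k hk))).neg
    have ha : Q a = 0 := by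
      have hlim' : Tendsto (fun t : ℝ => (Q a).eval t) atTop (𝓝 0) := by
        refine hlim.congr' ?_
        filter_upwards [eventually_gt_atTop 0] with t ht
        have h1 := hQ t ht
        rw [Finset.sum_insert has] at h1
        simp only [Real.exp_sub, ← mul_div_assoc]
        rw [← Finset.sum_div, neg_eq_iff_eq_neg, div_eq_iff (exp_pos _).ne']
        linarith
      exact Polynomial.leadingCoeff_eq_zero.1 ((Polynomial.tendsto_nhds_iff _).1 hlim').1
    intro k hk
    obtain rfl | hk := Finset.mem_insert.1 hk
    · exact ha
    · refine ih (fun t ht => ?_) k hk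
      have h1 := hQ t ht
      rwa [Finset.sum_insert has, ha, Polynomial.eval_zero, zero_mul, zero_add] at h1

/-- In a vanishing sum of nonzero polynomials the maximal degree is attained twice. -/
theorem exists_ne_natDegree_max_of_sum_eq_zero {S : Finset ℕ} (hS : S.Nonempty)
    (g : ℕ → Polynomial ℝ) (hg : ∀ j ∈ S, g j ≠ 0) (hsum : ∑ j ∈ S, g j = 0) :
    ∃ i ∈ S, ∃ j ∈ S, i < j ∧ (g i).natDegree = (g j).natDegree ∧
      ∀ l ∈ S, (g l).natDegree ≤ (g j).natDegree := by
  obtain ⟨a, ha, hmax⟩ := S.exists_max_image (fun j => (g j).natDegree) hS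
  obtain ⟨b, hb, hba, hdeg⟩ : ∃ b ∈ S, b ≠ a ∧ (g b).natDegree = (g a).natDegree := by
    by_contra! hcon
    have h1 := congrArg (fun P => P.coeff (g a).natDegree) hsum
    simp only [Polynomial.finsetSum_coeff, Polynomial.coeff_zero] at h1
    rw [Finset.sum_eq_single_of_mem a ha fun b hb hba =>
      Polynomial.coeff_eq_zero_of_natDegree_lt ((hmax b hb).lt_of_ne (hcon b hb hba))] at h1
    exact hg a ha (Polynomial.leadingCoeff_eq_zero.1 h1)
  rcases lt_or_gt_of_ne hba with hlt | hlt
  · exact ⟨b, hb, a, ha, hlt, hdeg, hmax⟩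
  · exact ⟨a, ha, b, hb, hlt, hdeg.symm, fun l hl => hdeg ▸ hmax l hl⟩

/-- If the maximum over `S` of the affine functions with slopes `j ∈ S` is attained at each of `n`
points by two functions whose slopes differ by at least `r`, then `S` contains some `j ≥ n * r`. -/
theorem exists_mul_le_mem_of_max_attained_twice {S : Finset ℕ} {n r : ℕ} (hn : 1 ≤ n)
    (D σ : ℕ → ℤ) (hσ : StrictMono σ)
    (H : ∀ k ∈ Finset.Icc 1 n, ∃ i ∈ S, ∃ j ∈ S, i + r ≤ j ∧ D i + i * σ k = D j + j * σ k ∧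
      ∀ l ∈ S, D l + l * σ k ≤ D j + j * σ k) :
    ∃ j ∈ S, n * r ≤ j := by
  suffices ∀ k, 1 ≤ k → k ≤ n → ∃ j ∈ S, k * r ≤ j ∧ ∀ l ∈ S, D l + l * σ k ≤ D j + j * σ k by
    obtain ⟨j, hj, hle, -⟩ := this n hn le_rfl
    exact ⟨j, hj, hle⟩
  intro k hk
  induction k, hk using Nat.le_induction with
  | base =>
    intro h1
    obtain ⟨i, -, j, hj, hij, -, hmax⟩ := H 1 (Finset.mem_Icc.2 ⟨le_rfl, h1⟩)
    exact ⟨j, hj, by omega, hmax⟩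
  | succ k hk ih =>
    intro hkn
    obtain ⟨a, ha, hka, hamax⟩ := ih (by omega)
    obtain ⟨i, hi, j, hj, hij, heq, hmax⟩ := H (k + 1) (Finset.mem_Icc.2 ⟨by omega, hkn⟩)
    refine ⟨j, hj, ?_, hmax⟩
    have hai : (a : ℤ) ≤ i := by
      have h1 := hamax i hi
      have h2 := hmax a ha
      have h3 := hσ (Nat.lt_succ_self k)
      by_contra! hlt
      nlinarith
    have : a ≤ i := by exact_mod_cast hai
    rw [Nat.succ_mul]
    omega

theorem exists_eval_eq_sum_eval_pow_mul_pow {r : ℕ} (hr : 0 < r) (P : Polynomial ℝ) :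
    ∃ u : Fin r → Polynomial ℝ, ∀ t : ℝ, P.eval t = ∑ i, (u i).eval (t ^ r) * t ^ (i : ℕ) := by
  induction P using Polynomial.induction_on' with
  | add P Q hP hQ =>
    obtain ⟨u, hu⟩ := hP
    obtain ⟨v, hv⟩ := hQ
    exact ⟨u + v, fun t => by simp [hu, hv, add_mul, Finset.sum_add_distrib]⟩
  | monomial d a =>
    refine ⟨Pi.single ⟨d % r, Nat.mod_lt d hr⟩ (Polynomial.monomial (d / r) a), fun t => ?_⟩
    rw [Finset.sum_eq_single_of_mem ⟨d % r, Nat.mod_lt d hr⟩ (Finset.mem_univ _)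
      (fun i _ hi => by simp [Pi.single_eq_of_ne hi])]
    rw [Pi.single_eq_same, Polynomial.eval_monomial, Polynomial.eval_monomial, ← pow_mul,
      mul_assoc, ← pow_add, Nat.div_add_mod]

theorem simpleDE_sum_exp_pow {r : ℕ} (hr : 0 < r) (s : Finset ℕ) (m : ℕ → ℕ) {h : ℝ → ℝ}
    (hh : ∀ x : ℝ, h x = ∑ k ∈ s, exp ((x ^ (1 / (r : ℝ))) ^ m k)) :
    SimpleDE h (s.card * r) (Set.Ioi 0) := by
  choose u hu using fun j k => exists_eval_eq_sum_eval_pow_mul_pow hr (eulerPoly r (m k) j)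
  obtain ⟨g, hg, a, ha⟩ : ∃ g : Fin (s.card * r + 1) → Polynomial ℝ,
      ∑ j, g j • (fun ki : s × Fin r => u j ki.1 ki.2) = 0 ∧ ∃ j, g j ≠ 0 := by
    rw [← Fintype.not_linearIndependent_iff]
    intro hli
    simpa using hli.fintype_card_le_finrank
  refine ⟨fun j => if hj : j < s.card * r + 1 then g ⟨j, hj⟩ * Polynomial.X ^ j else 0,
    ⟨a, Nat.lt_succ_iff.1 a.2, by simpa [Nat.lt_succ_iff.1 a.2] using ha⟩, fun x hx => ?_⟩
  rw [Finset.sum_range]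
  simp only [Fin.is_lt, dite_true, Polynomial.eval_mul, Polynomial.eval_pow, Polynomial.eval_X,
    mul_assoc]
  have hx : (0 : ℝ) < x := hx
  have htr : (x ^ (1 / (r : ℝ))) ^ r = x := by
    rw [one_div, Real.rpow_inv_natCast_pow hx.le hr.ne']
  have hzero : ∀ k ∈ s, ∀ i : Fin r, ∑ j, (g j).eval x * (u j k i).eval x = 0 := by
    intro k hk i
    have h1 := congrArg (Polynomial.eval x) (congrFun hg (⟨k, hk⟩, i))
    simpa [Polynomial.eval_finsetSum] using h1
  have hsum : ∀ k ∈ s, ∑ j : Fin (s.card * r + 1), (g j).eval x *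
      (eulerPoly r (m k) j).eval (x ^ (1 / (r : ℝ))) = 0 := by
    intro k hk
    simp only [hu, htr, Finset.mul_sum, ← mul_assoc]
    rw [Finset.sum_comm]
    simp only [← Finset.sum_mul, hzero k hk, zero_mul, Finset.sum_const_zero]
  simp only [pow_mul_iteratedDeriv_sum_exp hr s m hh _ x hx, Finset.mul_sum, ← mul_assoc]
  rw [Finset.sum_comm]
  refine Finset.sum_eq_zero fun k hk => ?_
  rw [← Finset.sum_mul, hsum k hk, zero_mul]

open Polynomial in
theorem not_simpleDE_sum_exp_pow {n q r : ℕ} (hn : 1 ≤ n) (hq : 0 < q) (hr : 0 < r) (hrq : r ∣ q)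
    {h : ℝ → ℝ}
    (hh : ∀ x : ℝ, h x = ∑ k ∈ Finset.Icc 1 n, exp ((x ^ (1 / (r : ℝ))) ^ (k * q + 1))) :
    ¬ SimpleDE h (n * r - 1) (Set.Ioi 0) := by
  rintro ⟨p, ⟨a, ha, hpa⟩, hp⟩
  have hnr : 0 < n * r := by positivity
  set N := n * r - 1 with hN
  set S := (Finset.range (N + 1)).filter fun j => p j ≠ 0 with hS
  have hSne : S.Nonempty := ⟨a, by simp [hS, hpa]; omega⟩
  set G : ℕ → ℕ → ℝ[X] := fun k j =>
    expand ℝ r (p j * X ^ (N - j)) * eulerPoly r (k * q + 1) j with hG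
  have hGeval : ∀ t : ℝ, 0 < t →
      ∑ k ∈ Finset.Icc 1 n, (∑ j ∈ S, G k j).eval t * exp (t ^ (k * q + 1)) = 0 := by
    intro t ht
    have hroot : (t ^ r) ^ (1 / (r : ℝ)) = t := by
      rw [one_div, Real.pow_rpow_inv_natCast ht.le hr.ne']
    have h1 := hp (t ^ r) (Set.mem_Ioi.2 (pow_pos ht r))
    have h2 := fun j => pow_mul_iteratedDeriv_sum_exp hr (Finset.Icc 1 n) (fun k => k * q + 1) hh j
      (t ^ r) (pow_pos ht r)
    simp only [hroot] at h2
    have h3 : ∑ j ∈ S, (p j).eval (t ^ r) * iteratedDeriv j h (t ^ r) = 0 := by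
      rw [hS, Finset.sum_filter_of_ne, h1]
      intro j _ hne h0
      exact hne (by simp [h0])
    rw [← mul_zero ((t ^ r) ^ N), ← h3, Finset.mul_sum]
    simp only [eval_finsetSum, Finset.sum_mul]
    rw [Finset.sum_comm]
    refine Finset.sum_congr rfl fun j hj => ?_
    have hjN : j ≤ N := by
      have := (Finset.mem_filter.1 hj).1
      rw [Finset.mem_range] at this
      omega
    have h4 : (t ^ r) ^ N = (t ^ r) ^ (N - j) * (t ^ r) ^ j := by
      rw [← pow_add, Nat.sub_add_cancel hjN]
    rw [h4, show (t ^ r) ^ (N - j) * (t ^ r) ^ j *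
      ((p j).eval (t ^ r) * iteratedDeriv j h (t ^ r)) = (t ^ r) ^ (N - j) * (p j).eval (t ^ r) *
      ((t ^ r) ^ j * iteratedDeriv j h (t ^ r)) by ring, h2, Finset.mul_sum]
    refine Finset.sum_congr rfl fun k _ => ?_
    simp only [hG, eval_mul, expand_eval, eval_pow, eval_X]
    ring
  have hm : StrictMono fun k => k * q + 1 := fun a b hab => by
    have := Nat.mul_lt_mul_of_pos_right hab hq
    simp only
    omega
  have hzero := eq_zero_of_sum_eval_mul_exp_pow_eq_zero (Finset.Icc 1 n) hm
    (fun k => Nat.succ_pos _) (fun k => ∑ j ∈ S, G k j) hGeval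
  have hGne : ∀ k, ∀ j ∈ S, G k j ≠ 0 := fun k j hj =>
    mul_ne_zero ((expand_ne_zero hr).2 (mul_ne_zero (Finset.mem_filter.1 hj).2
      (pow_ne_zero _ X_ne_zero))) (eulerPoly_ne_zero hr (Nat.succ_pos _) j)
  have hGdeg : ∀ k, ∀ j ∈ S, (G k j).natDegree =
      ((p j).natDegree + (N - j)) * r + j * (k * q + 1) := fun k j hj => by
    have hpj := (Finset.mem_filter.1 hj).2
    rw [hG]
    simp only
    rw [natDegree_mul ((expand_ne_zero hr).2 (mul_ne_zero hpj (pow_ne_zero _ X_ne_zero)))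
      (eulerPoly_ne_zero hr (Nat.succ_pos _) j), natDegree_expand, natDegree_eulerPoly hr
      (Nat.succ_pos _), natDegree_mul hpj (pow_ne_zero _ X_ne_zero), natDegree_X_pow]
  obtain ⟨j, hj, hle⟩ := exists_mul_le_mem_of_max_attained_twice (S := S) (r := r) hn
    (fun j => (((p j).natDegree + (N - j)) * r : ℕ)) (fun k => (k * q + 1 : ℕ))
    (fun a b hab => Nat.cast_lt.2 (hm hab)) fun k hk => by
      obtain ⟨i, hi, j, hj, hij, hdeg, hmax⟩ :=
        exists_ne_natDegree_max_of_sum_eq_zero hSne (G k) (hGne k) (hzero k hk)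
      refine ⟨i, hi, j, hj, ?_, ?_, fun l hl => ?_⟩
      · rw [hGdeg k i hi, hGdeg k j hj] at hdeg
        obtain ⟨c, rfl⟩ := hrq
        have hmod : i ≡ j [MOD r] := by
          have h1 := congrArg (· % r) hdeg
          have h2 : ∀ A j : ℕ, (A * r + j * (k * (r * c) + 1)) % r = j % r := fun A j => by
            rw [show A * r + j * (k * (r * c) + 1) = j + r * (A + j * k * c) by ring,
              Nat.add_mul_mod_self_left]
          simp only [h2] at h1
          exact h1
        have := Nat.le_of_dvd (by omega) ((Nat.modEq_iff_dvd' hij.le).1 hmod)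
        omega
      · rw [hGdeg k i hi, hGdeg k j hj] at hdeg
        exact_mod_cast hdeg
      · have := hmax l hl
        rw [hGdeg k l hl, hGdeg k j hj] at this
        exact_mod_cast this
  have := Finset.mem_range.1 (Finset.mem_filter.1 hj).1
  omega

theorem SimpleDE.mono {f : ℝ → ℝ} {n : ℕ} {S T : Set ℝ} (hST : S ⊆ T) (h : SimpleDE f n T) :
    SimpleDE f n S := by
  obtain ⟨p, hp, hf⟩ := h
  exact ⟨p, hp, fun x hx => hf x (hST hx)⟩

theorem SimpleDE.univ_of_Ioi {f : ℝ → ℝ} {n : ℕ} (hf : AnalyticOnNhd ℝ f Set.univ) {a : ℝ}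
    (h : SimpleDE f n (Set.Ioi a)) : SimpleDE f n Set.univ := by
  obtain ⟨p, hp, hzero⟩ := h
  refine ⟨p, hp, fun x hx => ?_⟩
  have hana : AnalyticOnNhd ℝ (fun x => ∑ k ∈ Finset.range (n + 1),
      (p k).eval x * iteratedDeriv k f x) Set.univ :=
    Finset.analyticOnNhd_fun_sum _ fun k _ =>
      (AnalyticOnNhd.eval_polynomial (p k)).mul (iteratedDeriv_eq_iterate (𝕜 := ℝ) (f := f) ▸ hf.iterated_deriv k)
  refine hana.eqOn_zero_of_preconnected_of_eventuallyEq_zero isPreconnected_univ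
    (Set.mem_univ (a + 1)) ?_ hx
  filter_upwards [lt_mem_nhds (lt_add_one a)] with y hy
  exact hzero y hy

theorem sharp_rpow_comp (n q : ℕ) (hn : 1 ≤ n) (hq : 1 ≤ q)
    (f : ℝ → ℝ) (hf : ∀ x : ℝ, f x = ∑ k ∈ Finset.Icc 1 n, Real.exp (x ^ (k * q + 1)))
    (h : ℝ → ℝ) (hh : ∀ x : ℝ, h x = f (x ^ (1 / (q : ℝ)))) :
    ExactOrder f n Set.univ ∧ ExactOrder h (n * q) (Set.Ioi 0) := by
  have hh' : ∀ x : ℝ, h x = ∑ k ∈ Finset.Icc 1 n, exp ((x ^ (1 / (q : ℝ))) ^ (k * q + 1)) :=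
    fun x => by rw [hh, hf]
  have hf' : ∀ x : ℝ, f x =
      ∑ k ∈ Finset.Icc 1 n, exp ((x ^ (1 / ((1 : ℕ) : ℝ))) ^ (k * q + 1)) := by
    simpa using hf
  have hana : AnalyticOnNhd ℝ f Set.univ := by
    rw [funext hf]
    exact Finset.analyticOnNhd_fun_sum _ fun k _ => (analyticOnNhd_id.pow (k * q + 1)).rexp
  refine ⟨⟨SimpleDE.univ_of_Ioi hana (a := 0) ?_, fun hcon => ?_⟩, ?_,
    not_simpleDE_sum_exp_pow hn hq hq dvd_rfl hh'⟩
  · simpa using simpleDE_sum_exp_pow one_pos (Finset.Icc 1 n) (fun k => k * q + 1) hf'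
  · refine not_simpleDE_sum_exp_pow hn hq one_pos (one_dvd q) hf' ?_
    rw [mul_one]
    exact hcon.mono (Set.subset_univ _)
  · simpa using simpleDE_sum_exp_pow hq (Finset.Icc 1 n) (fun k => k * q + 1) hh'
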